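/- The μ-function is symmetric: μ(z₁, z₂; τ) = μ(z₂, z₁; τ) for all z₁, z₂ ∈ ℂ \ (ℤτ + ℤ) and τ ∈ ℍ, where μ(z₁,z₂;τ) = (ζ₁^{1/2}/ϑ(z₂;τ))·∑_{n∈ℤ} (-ζ₂)ⁿ q^{n(n+1)/2}/(1 - ζ₁qⁿ). -/

import Mathlib

/-- The Jacobi theta function ϑ(z;τ) = ∑_{n ∈ 1/2+ℤ} q^{n²/2} e^{2πi(z+1/2)n}. -/
noncomputable def jTheta (z τ : ℂ) : ℂ :=
  ∑' n : ℤ, Complex.exp (Real.pi * Complex.I * τ * ((n : ℂ) + 1 / 2) ^ 2) *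
    Complex.exp (2 * Real.pi * Complex.I * (z + 1 / 2) * ((n : ℂ) + 1 / 2))

/-- Zwegers' μ-function, μ(z₁,z₂;τ) = (ζ₁^{1/2}/ϑ(z₂;τ)) ∑_{n∈ℤ} (-ζ₂)ⁿ q^{n(n+1)/2}/(1-ζ₁qⁿ). -/
noncomputable def mu (z₁ z₂ τ : ℂ) : ℂ :=
  Complex.exp (Real.pi * Complex.I * z₁) / jTheta z₂ τ *
    ∑' n : ℤ, (-Complex.exp (2 * Real.pi * Complex.I * z₂)) ^ n *
        Complex.exp (Real.pi * Complex.I * τ * (n : ℂ) * ((n : ℂ) + 1)) /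
      (1 - Complex.exp (2 * Real.pi * Complex.I * z₁) *
        Complex.exp (2 * Real.pi * Complex.I * τ) ^ n)

/-- `z` does not lie in the lattice ℤτ + ℤ. -/
def NotLattice (z τ : ℂ) : Prop := ∀ m n : ℤ, z ≠ m * τ + n

open Complex

/-- Coefficients of the theta series. -/
noncomputable def bb (τ : ℂ) (k : ℤ) : ℂ :=
  cexp (Real.pi * I * k + Real.pi * I * k * (k - 1) * τ)

/-- Partial sums of the theta coefficients, written as a tail. -/
noncomputable def cc (τ : ℂ) (k : ℤ) : ℂ := -∑' j : ℕ, bb τ (|k| + 1 + j)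

/-- Normalized theta series. -/
noncomputable def JJ (τ z : ℂ) : ℂ := ∑' k : ℤ, bb τ k * cexp (2 * Real.pi * I * (k * z))

/-- Numerator of the Appell sum. -/
noncomputable def aa (τ z : ℂ) (n : ℤ) : ℂ :=
  cexp (Real.pi * I * n + 2 * Real.pi * I * (n * z) + Real.pi * I * τ * n * (n + 1))

/-- Appell sum. -/
noncomputable def SS (τ z₁ z₂ : ℂ) : ℂ :=
  ∑' n : ℤ, aa τ z₂ n / (1 - cexp (2 * Real.pi * I * (z₁ + n * τ)))

/-- The symmetric double series. -/
noncomputable def GG (τ z₁ z₂ : ℂ) (l n : ℤ) : ℂ :=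
  cc τ (l - n) * cexp (2 * Real.pi * I * (l * z₁ + n * z₂ + n * l * τ))

lemma bb_mul_eq (τ z : ℂ) (k : ℤ) :
    bb τ k * cexp (2 * Real.pi * I * (k * z)) = jacobiTheta₂_term k (z + 1 / 2 - τ / 2) τ := by
  rw [bb, jacobiTheta₂_term, ← Complex.exp_add]
  congr 1; ring

lemma JJ_eq (τ z : ℂ) : JJ τ z = jacobiTheta₂ (z + 1 / 2 - τ / 2) τ := by
  simp only [JJ, jacobiTheta₂, bb_mul_eq]

lemma bb_eq (τ : ℂ) (k : ℤ) : bb τ k = jacobiTheta₂_term k (1 / 2 - τ / 2) τ := by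
  have := bb_mul_eq τ 0 k
  simpa using this

lemma bb_summable (τ : ℂ) (hτ : 0 < τ.im) : Summable (bb τ) := by
  have := (summable_jacobiTheta₂_term_iff (1 / 2 - τ / 2) τ).2 hτ
  exact this.congr fun k => (bb_eq τ k).symm

lemma norm_bb (τ : ℂ) (k : ℤ) : ‖bb τ k‖ = Real.exp (-Real.pi * τ.im * (k * (k - 1))) := by
  rw [bb_eq, norm_jacobiTheta₂_term]
  congr 1
  have : (1 / 2 - τ / 2 : ℂ).im = - τ.im / 2 := by simp; ring
  rw [this]; ring

lemma exp_int_pi (k : ℤ) : cexp (Real.pi * I * k) = (-1) ^ k := by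
  rw [mul_comm, Complex.exp_int_mul, Complex.exp_pi_mul_I]

lemma bb_neg (τ : ℂ) (k : ℤ) : bb τ (-k) = - bb τ (k + 1) := by
  have h1 : bb τ (-k) = cexp (Real.pi * I * (k + 1) + Real.pi * I * (k + 1) * k * τ
      + (-(2 * k + 1 : ℤ) : ℤ) * (Real.pi * I)) := by
    rw [bb]; congr 1; push_cast; ring
  rw [h1, Complex.exp_add, Complex.exp_int_mul, Complex.exp_pi_mul_I, bb]
  have : ((-1 : ℂ)) ^ (-(2 * k + 1)) = -1 := by
    apply Odd.neg_one_zpow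
    exact ⟨-k - 1, by ring⟩
  rw [this]
  push_cast
  rw [mul_neg_one]; congr 3; ring

lemma cc_neg (τ : ℂ) (k : ℤ) : cc τ (-k) = cc τ k := by simp [cc]

lemma cc_nat_rec (τ : ℂ) (hτ : 0 < τ.im) (k : ℕ) :
    cc τ (k + 1 : ℕ) - cc τ k = bb τ (k + 1) := by
  have hs : Summable fun j : ℕ => bb τ ((k : ℤ) + 1 + j) := by
    refine (bb_summable τ hτ).comp_injective (i := fun j : ℕ => (k : ℤ) + 1 + j) ?_
    intro a b h; simpa using h
  have h := hs.tsum_eq_zero_add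
  have e : ∀ j : ℕ, bb τ ((k : ℤ) + 1 + (j + 1 : ℕ)) = bb τ (|((k + 1 : ℕ) : ℤ)| + 1 + j) := by
    intro j; congr 1; rw [abs_of_nonneg (by positivity)]; push_cast; ring
  simp only [e] at h
  rw [cc, cc, abs_of_nonneg (by positivity : (0 : ℤ) ≤ k), h]
  simp

lemma cc_rec (τ : ℂ) (hτ : 0 < τ.im) (k : ℤ) : cc τ k - cc τ (k - 1) = bb τ k := by
  rcases le_or_gt k 0 with h | h
  · obtain ⟨l, hl⟩ := Int.eq_ofNat_of_zero_le (neg_nonneg.2 h)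
    obtain rfl : k = -(l : ℤ) := by omega
    have h2 : -(l : ℤ) - 1 = -((l + 1 : ℕ) : ℤ) := by push_cast; ring
    rw [h2, cc_neg, cc_neg, bb_neg, ← cc_nat_rec τ hτ]; ring
  · obtain ⟨l, hl⟩ := Int.eq_ofNat_of_zero_le (by omega : 0 ≤ k - 1)
    obtain rfl : k = (l : ℤ) + 1 := by omega
    have := cc_nat_rec τ hτ l
    simpa using this

lemma cc_bound (τ : ℂ) (hτ : 0 < τ.im) :
    ∃ C : ℝ, ∀ k : ℤ, ‖cc τ k‖ ≤ C * Real.exp (-Real.pi * τ.im * k ^ 2) := by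
  have hr : Real.exp (-Real.pi * τ.im) < 1 := by
    rw [Real.exp_lt_one_iff]; nlinarith [Real.pi_pos]
  have hsum : Summable fun j : ℕ => Real.exp (-Real.pi * τ.im) ^ j :=
    summable_geometric_of_lt_one (Real.exp_pos _).le hr
  refine ⟨∑' j : ℕ, Real.exp (-Real.pi * τ.im) ^ j, fun k => ?_⟩
  rw [cc, norm_neg, ← tsum_mul_right]
  apply tsum_of_norm_bounded (hsum.mul_right _).hasSum
  intro j
  rw [norm_bb, ← Real.exp_nat_mul, ← Real.exp_add]
  apply Real.exp_le_exp.2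
  push_cast
  have h0 : (0 : ℝ) ≤ |(k : ℝ)| := abs_nonneg _
  have h2 : (k : ℝ) ^ 2 = |(k : ℝ)| ^ 2 := (sq_abs _).symm
  rw [h2]
  generalize |(k : ℝ)| = x at *
  have hj : (0 : ℝ) ≤ j := by positivity
  have hp : 0 < Real.pi * τ.im := mul_pos Real.pi_pos hτ
  have : (j : ℝ) + x ^ 2 ≤ (x + 1 + j) * (x + 1 + j - 1) := by nlinarith [mul_nonneg h0 hj]
  nlinarith [mul_le_mul_of_nonneg_left this hp.le]

lemma GG_summable (τ z₁ z₂ : ℂ) (hτ : 0 < τ.im) :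
    Summable fun p : ℤ × ℤ => GG τ z₁ z₂ p.1 p.2 := by
  obtain ⟨C, hC⟩ := cc_bound τ hτ
  have h1 := ((summable_jacobiTheta₂_term_iff z₁ τ).2 hτ).norm
  have h2 := ((summable_jacobiTheta₂_term_iff z₂ τ).2 hτ).norm
  have h3 := (h1.mul_of_nonneg h2 (fun _ => norm_nonneg _) (fun _ => norm_nonneg _)).mul_left C
  refine Summable.of_norm_bounded h3 ?_
  rintro ⟨l, n⟩
  simp only [GG, norm_mul, norm_jacobiTheta₂_term]
  refine (mul_le_mul_of_nonneg_right (hC _) (norm_nonneg _)).trans (le_of_eq ?_)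
  rw [mul_assoc, Complex.norm_exp, ← Real.exp_add, ← Real.exp_add]
  congr 2
  have : (2 * Real.pi * I * (l * z₁ + n * z₂ + n * l * τ)).re
      = -(2 * Real.pi * (l * z₁.im + n * z₂.im + n * l * τ.im)) := by
    have e : (2 * Real.pi * I * (l * z₁ + n * z₂ + n * l * τ) : ℂ) =
      ((2 * Real.pi * l : ℝ) : ℂ) * z₁ * I + ((2 * Real.pi * n : ℝ) : ℂ) * z₂ * I
        + ((2 * Real.pi * n * l : ℝ) : ℂ) * τ * I := by push_cast; ring
    rw [e, add_re, add_re, mul_I_re, im_ofReal_mul, mul_I_re, im_ofReal_mul, mul_I_re,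
      im_ofReal_mul]
    ring
  rw [this]; push_cast; ring

lemma one_sub_ne (τ z : ℂ) (h : NotLattice z τ) (n : ℤ) :
    1 - cexp (2 * Real.pi * I * (z + n * τ)) ≠ 0 := by
  intro h0
  obtain ⟨m, hm⟩ := Complex.exp_eq_one_iff.1 (sub_eq_zero.1 h0).symm
  have hpi : (2 * Real.pi * I : ℂ) ≠ 0 := Complex.two_pi_I_ne_zero
  apply h (-n) m
  have : z + n * τ = m := by
    apply mul_left_cancel₀ hpi; rw [hm]; ring
  push_cast; linear_combination this

lemma GG_row (τ z₁ z₂ : ℂ) (hτ : 0 < τ.im) (h : NotLattice z₁ τ) (n : ℤ) :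
    ∑' l : ℤ, GG τ z₁ z₂ l n =
      JJ τ z₁ * (aa τ z₂ n / (1 - cexp (2 * Real.pi * I * (z₁ + n * τ)))) := by
  have hne := one_sub_ne τ z₁ h n
  have hs : Summable fun l : ℤ => GG τ z₁ z₂ l n :=
    (GG_summable τ z₁ z₂ hτ).comp_injective (i := fun l : ℤ => (l, n))
      (fun a b hab => by simpa using hab)
  rw [← mul_div_assoc, eq_div_iff hne, mul_sub, mul_one]
  have hsh : ∑' l : ℤ, GG τ z₁ z₂ (l - 1) n = ∑' l : ℤ, GG τ z₁ z₂ l n :=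
    (Equiv.subRight (1 : ℤ)).tsum_eq (fun l => GG τ z₁ z₂ l n)
  have hss : Summable fun l : ℤ => GG τ z₁ z₂ (l - 1) n :=
    ((Equiv.subRight (1 : ℤ)).summable_iff (f := fun l => GG τ z₁ z₂ l n)).2 hs
  nth_rewrite 2 [← hsh]
  rw [← tsum_mul_right, ← hs.tsum_sub (hss.mul_right _), JJ, ← tsum_mul_right]
  congr 1; ext l
  have e1 : GG τ z₁ z₂ (l - 1) n * cexp (2 * Real.pi * I * (z₁ + n * τ)) =
      cc τ (l - n - 1) * cexp (2 * Real.pi * I * (l * z₁ + n * z₂ + n * l * τ)) := by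
    rw [GG, mul_assoc, ← Complex.exp_add]
    congr 2
    · ring
    · push_cast; ring
  rw [e1, GG, ← sub_mul, cc_rec τ hτ, bb, bb, aa, ← Complex.exp_add, ← Complex.exp_add,
    ← Complex.exp_add, Complex.exp_eq_exp_iff_exists_int]
  exact ⟨-n, by push_cast; ring⟩

lemma key (τ z₁ z₂ : ℂ) (hτ : 0 < τ.im) (h₁ : NotLattice z₁ τ) (h₂ : NotLattice z₂ τ) :
    JJ τ z₁ * SS τ z₁ z₂ = JJ τ z₂ * SS τ z₂ z₁ := by
  rw [SS, SS, ← tsum_mul_left, ← tsum_mul_left]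
  simp only [← GG_row τ z₁ z₂ hτ h₁, ← GG_row τ z₂ z₁ hτ h₂]
  have hsw : ∀ l n, GG τ z₂ z₁ l n = GG τ z₁ z₂ n l := by
    intro l n
    rw [GG, GG, ← cc_neg]
    congr 2
    · ring
    · ring
  simp only [hsw]
  exact (GG_summable τ z₁ z₂ hτ).tsum_comm (f := fun l n => GG τ z₁ z₂ l n)

lemma jTheta_eq (τ z : ℂ) : jTheta z τ =
    cexp (Real.pi * I * τ / 4 - Real.pi * I * z - Real.pi * I / 2) * JJ τ z := by
  rw [JJ, ← (Equiv.addRight (1 : ℤ)).tsum_eq, ← tsum_mul_left, jTheta]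
  congr 1; ext n
  rw [bb, ← Complex.exp_add, ← Complex.exp_add, ← Complex.exp_add]
  congr 1
  simp only [Equiv.coe_addRight]; push_cast; ring

lemma mu_eq (τ z₁ z₂ : ℂ) : mu z₁ z₂ τ =
    cexp (Real.pi * I * (z₁ + z₂)) / cexp (Real.pi * I * τ / 4 - Real.pi * I / 2) *
      (SS τ z₁ z₂ / JJ τ z₂) := by
  have hS : ∑' n : ℤ, (-Complex.exp (2 * Real.pi * Complex.I * z₂)) ^ n *
        Complex.exp (Real.pi * Complex.I * τ * (n : ℂ) * ((n : ℂ) + 1)) /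
      (1 - Complex.exp (2 * Real.pi * Complex.I * z₁) *
        Complex.exp (2 * Real.pi * Complex.I * τ) ^ n) = SS τ z₁ z₂ := by
    rw [SS]; congr 1; ext n
    congr 2
    · rw [← neg_one_mul, mul_zpow, ← exp_int_pi, ← Complex.exp_int_mul, aa, ← Complex.exp_add,
        ← Complex.exp_add]
      congr 1; ring
    · rw [← Complex.exp_int_mul, ← Complex.exp_add]
      congr 1; ring_nf
  rw [mu, hS, jTheta_eq, mul_add, Complex.exp_add,
    show (Real.pi * I * τ / 4 - Real.pi * I * z₂ - Real.pi * I / 2 : ℂ)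
      = (Real.pi * I * τ / 4 - Real.pi * I / 2) + -(Real.pi * I * z₂) by ring, Complex.exp_add,
      Complex.exp_neg]
  have := Complex.exp_ne_zero (Real.pi * I * z₂)
  by_cases hJ : JJ τ z₂ = 0
  · simp [hJ]
  field_simp

lemma theta_integral (τ : ℂ) (hτ : 0 < τ.im) :
    ∫ x in Set.Ioc (0 : ℝ) 1, jacobiTheta₂ x τ = 1 := by
  have hn : ∀ (n : ℤ) (x : ℝ), ‖jacobiTheta₂_term n x τ‖ = ‖jacobiTheta₂_term n 0 τ‖ := by
    intro n x; simp [norm_jacobiTheta₂_term]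
  have hc : ∀ n : ℤ, Continuous fun x : ℝ => jacobiTheta₂_term n x τ := by
    intro n; unfold jacobiTheta₂_term; fun_prop
  have h := MeasureTheory.hasSum_integral_of_summable_integral_norm
    (μ := MeasureTheory.volume.restrict (Set.Ioc (0 : ℝ) 1))
    (F := fun (n : ℤ) (x : ℝ) => jacobiTheta₂_term n x τ)
    (fun n => (hc n).integrableOn_Ioc)
    (by
      simp only [hn]
      simpa using ((summable_jacobiTheta₂_term_iff 0 τ).2 hτ).norm)
  have h0 : ∀ n : ℤ, n ≠ 0 → ∫ x in Set.Ioc (0 : ℝ) 1, jacobiTheta₂_term n x τ = 0 := by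
    intro n hn0
    rw [← intervalIntegral.integral_of_le zero_le_one]
    have e : ∀ x : ℝ, jacobiTheta₂_term n x τ =
        cexp ((2 * Real.pi * I * n) * x) * cexp (Real.pi * I * n ^ 2 * τ) := by
      intro x; rw [jacobiTheta₂_term, Complex.exp_add]
    simp only [e]
    rw [intervalIntegral.integral_mul_const, integral_exp_mul_complex (by
      simp [hn0, Real.pi_ne_zero])]
    have : cexp (2 * Real.pi * I * n * (1 : ℝ)) = 1 :=
      Complex.exp_eq_one_iff.2 ⟨n, by push_cast; ring⟩
    rw [this]; simp
  have h1 := h.unique (hasSum_single 0 h0)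
  change ∫ x in Set.Ioc (0 : ℝ) 1, ∑' n : ℤ, jacobiTheta₂_term n x τ = 1
  rw [h1]
  simp [jacobiTheta₂_term]

lemma JJ_eventually (τ : ℂ) (hτ : 0 < τ.im) :
    ∀ᶠ z in nhdsWithin (0 : ℂ) {0}ᶜ, JJ τ z ≠ 0 := by
  have hd : Differentiable ℂ (JJ τ) := by
    have : JJ τ = fun z => jacobiTheta₂ (z + 1 / 2 - τ / 2) τ := funext (JJ_eq τ)
    rw [this]
    intro z
    exact (differentiableAt_jacobiTheta₂_fst (z + 1 / 2 - τ / 2) hτ).comp z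
      (f := fun z : ℂ => z + 1 / 2 - τ / 2) (by fun_prop)
  have ha : AnalyticOnNhd ℂ (JJ τ) Set.univ := fun z _ => hd.analyticAt z
  rcases (hd.analyticAt 0).eventually_eq_zero_or_eventually_ne_zero with h | h
  · exfalso
    have h0 : JJ τ = 0 := ha.eq_of_eventuallyEq (fun z _ => analyticAt_const) h
    have h1 := theta_integral τ hτ
    have h2 : ∀ x : ℝ, jacobiTheta₂ x τ = 0 := by
      intro x
      have := congrFun h0 (x - 1 / 2 + τ / 2)
      rw [JJ_eq] at this
      ring_nf at this
      simpa using this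
    simp [h2] at h1
  · exact h

lemma aa_summable (τ z : ℂ) (hτ : 0 < τ.im) : Summable (aa τ z) := by
  refine ((summable_jacobiTheta₂_term_iff (z + 1 / 2 + τ / 2) τ).2 hτ).congr fun n => ?_
  rw [aa, jacobiTheta₂_term]; congr 1; ring

lemma denom_bound (τ : ℂ) (hτ : 0 < τ.im) (t : ℝ) (n : ℤ) (hn : n ≠ 0) :
    1 - Real.exp (-(2 * Real.pi * τ.im)) ≤ ‖1 - cexp (2 * Real.pi * I * (t + n * τ))‖ := by
  have hnorm : ‖cexp (2 * Real.pi * I * (t + n * τ))‖ = Real.exp (n * -(2 * Real.pi * τ.im)) := by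
    rw [Complex.norm_exp]; congr 1
    have e : (2 * Real.pi * I * (t + n * τ) : ℂ) =
      ((2 * Real.pi * t : ℝ) : ℂ) * I + ((2 * Real.pi * n : ℝ) : ℂ) * τ * I := by push_cast; ring
    rw [e, add_re, mul_I_re, mul_I_re, im_ofReal_mul, ofReal_im]; ring
  have hp : 0 < 2 * Real.pi * τ.im := by have := Real.pi_pos; positivity
  generalize 2 * Real.pi * τ.im = a at *
  rcases lt_or_gt_of_ne hn with h | h
  · have hn1 : (n : ℝ) ≤ -1 := by exact_mod_cast (by omega : n ≤ -1)
    have h1 : Real.exp a ≤ Real.exp (n * -a) := Real.exp_le_exp.2 (by nlinarith)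
    have h2 := norm_sub_norm_le (cexp (2 * Real.pi * I * (t + n * τ))) 1
    rw [norm_sub_rev, hnorm, norm_one] at h2
    have := Real.add_one_le_exp a
    have := Real.add_one_le_exp (-a)
    linarith
  · have hn1 : (1 : ℝ) ≤ n := by exact_mod_cast (by omega : 1 ≤ n)
    have h1 : Real.exp (n * -a) ≤ Real.exp (-a) := Real.exp_le_exp.2 (by nlinarith)
    have h2 := norm_sub_norm_le 1 (cexp (2 * Real.pi * I * (t + n * τ)))
    rw [hnorm, norm_one] at h2
    linarith

lemma SS_ne (τ y : ℂ) (hτ : 0 < τ.im) (t : ℝ) (hS : SS τ t y = 0)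
    (ht : 1 - cexp (2 * Real.pi * I * t) ≠ 0) :
    1 - Real.exp (-(2 * Real.pi * τ.im)) ≤
      ‖1 - cexp (2 * Real.pi * I * t)‖ * ∑' n : ℤ, ‖aa τ y n‖ := by
  set d := 1 - Real.exp (-(2 * Real.pi * τ.im)) with hd
  have hdpos : 0 < d := by
    have : Real.exp (-(2 * Real.pi * τ.im)) < 1 := by
      rw [Real.exp_lt_one_iff]; have := Real.pi_pos; have : 0 < 2 * Real.pi * τ.im := by positivity
      linarith
    rw [hd]; linarith
  have ha := (aa_summable τ y hτ).norm
  have hb := ha.mul_right d⁻¹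
  set f : ℤ → ℂ := fun n => aa τ y n / (1 - cexp (2 * Real.pi * I * (t + n * τ))) with hf
  have hfb : ∀ n, n ≠ 0 → ‖f n‖ ≤ ‖aa τ y n‖ * d⁻¹ := by
    intro n hn
    rw [hf]; simp only [norm_div]
    rw [div_eq_mul_inv]
    gcongr
    exact denom_bound τ hτ t n hn
  have hib : ∀ n, ‖if n = 0 then 0 else f n‖ ≤ ‖aa τ y n‖ * d⁻¹ := by
    intro n
    by_cases hn : n = 0
    · simp only [hn, if_true, norm_zero]; positivity
    · simpa [hn] using hfb n hn
  have hi : Summable fun n => if n = 0 then 0 else f n := Summable.of_norm_bounded hb hib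
  have hfs : Summable f := by
    refine hi.congr_cofinite ?_
    filter_upwards [(Set.finite_singleton (0 : ℤ)).compl_mem_cofinite] with n hn
    have : n ≠ 0 := hn
    simp [this]
  have h1 := hfs.tsum_eq_add_tsum_ite 0
  have h2 : ∑' n, f n = 0 := hS
  have h3 : f 0 = 1 / (1 - cexp (2 * Real.pi * I * t)) := by simp [hf, aa]
  have h4 : ‖f 0‖ ≤ ∑' n, ‖aa τ y n‖ * d⁻¹ := by
    have : f 0 = - ∑' n, if n = 0 then 0 else f n := by
      rw [h2] at h1; linear_combination -h1
    rw [this, norm_neg]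
    exact tsum_of_norm_bounded hb.hasSum hib
  rw [h3, tsum_mul_right, norm_div, norm_one, div_le_iff₀ (norm_pos_iff.2 ht), ← div_eq_mul_inv,
    div_mul_eq_mul_div, le_div_iff₀ hdpos] at h4
  linarith

lemma JJ_ne (τ y : ℂ) (hτ : 0 < τ.im) (hy : NotLattice y τ) : JJ τ y ≠ 0 := by
  intro h0
  have hdpos : 0 < 1 - Real.exp (-(2 * Real.pi * τ.im)) := by
    have : Real.exp (-(2 * Real.pi * τ.im)) < 1 := by
      rw [Real.exp_lt_one_iff]; have := Real.pi_pos; have : 0 < 2 * Real.pi * τ.im := by positivity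
      linarith
    linarith
  have hlim : Filter.Tendsto
      (fun t : ℝ => ‖1 - cexp (2 * Real.pi * I * t)‖ * ∑' n : ℤ, ‖aa τ y n‖)
      (nhdsWithin 0 (Set.Ioi 0)) (nhds 0) := by
    have hc : Continuous
      (fun t : ℝ => ‖1 - cexp (2 * Real.pi * I * t)‖ * ∑' n : ℤ, ‖aa τ y n‖) := by fun_prop
    have := (hc.tendsto 0).mono_left (nhdsWithin_le_nhds (s := Set.Ioi 0))
    simpa using this
  have hofR : Filter.Tendsto (fun t : ℝ => (t : ℂ)) (nhdsWithin 0 (Set.Ioi 0))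
      (nhdsWithin (0 : ℂ) {0}ᶜ) := by
    apply tendsto_nhdsWithin_of_tendsto_nhds_of_eventually_within
    · have := (Complex.continuous_ofReal.tendsto 0).mono_left
        (nhdsWithin_le_nhds (s := Set.Ioi 0))
      simpa using this
    · filter_upwards [self_mem_nhdsWithin] with t ht
      have : 0 < t := ht
      simp [this.ne']
  have e1 := hlim.eventually (gt_mem_nhds hdpos)
  have e2 := hofR.eventually (JJ_eventually τ hτ)
  have e3 : ∀ᶠ t : ℝ in nhdsWithin 0 (Set.Ioi 0), t ∈ Set.Ioo (0 : ℝ) 1 :=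
    Ioo_mem_nhdsGT one_pos
  obtain ⟨t, h1, h2, h3, h4⟩ := (e1.and (e2.and e3)).exists
  have hnl : NotLattice t τ := by
    intro m n hmn
    have him := congrArg Complex.im hmn
    simp at him
    have hm : m = 0 := by
      rcases him with h | h
      · exact h
      · exact absurd h hτ.ne'
    subst hm
    have hre := congrArg Complex.re hmn
    simp at hre
    rw [hre] at h3 h4
    have a1 : 0 < n := by exact_mod_cast h3
    have a2 : n < 1 := by exact_mod_cast h4
    omega
  have hk := key τ t y hτ hnl hy
  rw [h0, zero_mul] at hk
  have hS := (mul_eq_zero.1 hk).resolve_left h2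
  have hne := one_sub_ne τ t hnl 0
  simp only [Int.cast_zero, zero_mul, add_zero] at hne
  exact absurd h1 (not_lt.2 (SS_ne τ y hτ t hS hne))

theorem stmt12 (τ z₁ z₂ : ℂ) (hτ : 0 < τ.im)
    (h₁ : NotLattice z₁ τ) (h₂ : NotLattice z₂ τ) :
    mu z₁ z₂ τ = mu z₂ z₁ τ := by
  have hJ1 := JJ_ne τ z₁ hτ h₁
  have hJ2 := JJ_ne τ z₂ hτ h₂
  have hk := key τ z₁ z₂ hτ h₁ h₂
  rw [mu_eq, mu_eq, add_comm z₁ z₂]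
  congr 1
  rw [div_eq_div_iff hJ2 hJ1]
  linear_combination hk
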